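/- Let s be a string and c a character, and suppose the family S(s,·) satisfies Eq.(★) for s. Let v' = sufpal(sc,|sc|), the longest palindromic suffix of sc. Define, for each non-empty palindromic substring v of sc: S(sc,v) = S(s,v) ∪ {|sc| − |v'| + 1} if v = v', and S(sc,v) = S(s,v) otherwise, where S(s,v) = ∅ if v is not a substring of s. Then the family S(sc,·) satisfies Eq.(★) for sc. -/

import Mathlib

noncomputable section
open scoped Classical

namespace DEE

variable {α : Type*}

/-- 1-indexed substring `s[i..j]` (empty if `i > j`). -/
def substr (s : List α) (i j : ℕ) : List α := (s.drop (i - 1)).take (j + 1 - i)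

/-- Set of start positions (1-indexed) of occurrences of `t` in `s`. -/
def occ (s t : List α) : Set ℕ :=
  {i | 1 ≤ i ∧ i + t.length - 1 ≤ s.length ∧ (s.drop (i - 1)).take t.length = t}

/-- `v` is a non-empty palindromic substring of `s`. -/
def IsPalSub (s v : List α) : Prop := v ≠ [] ∧ v.Palindrome ∧ v <:+: s

/-- `prelen s i`: length of the longest palindromic prefix of `s[i..|s|]`. -/
def prelen (s : List α) (i : ℕ) : ℕ :=
  sSup {l | 1 ≤ l ∧ l ≤ s.length + 1 - i ∧ (substr s i (i + l - 1)).Palindrome}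

/-- `suflen s i`: length of the longest palindromic suffix of `s[1..i]`. -/
def suflen (s : List α) (i : ℕ) : ℕ :=
  sSup {l | 1 ≤ l ∧ l ≤ i ∧ (substr s (i + 1 - l) i).Palindrome}

/-- longest palindromic prefix of `s[i..|s|]`. -/
def prepal (s : List α) (i : ℕ) : List α := substr s i (i + prelen s i - 1)

/-- longest palindromic suffix of `s[1..i]`. -/
def sufpal (s : List α) (i : ℕ) : List α := substr s (i + 1 - suflen s i) i

/-- The occurrence `s[i..j]` is a surface in `s`. -/
def Surface (s : List α) (i j : ℕ) : Prop :=
  1 ≤ i ∧ i ≤ j ∧ j ≤ s.length ∧ (substr s i j).Palindrome ∧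
    (∀ l, 1 ≤ l → l < i → ¬ (substr s l j).Palindrome) ∧
    (∀ r, j < r → r ≤ s.length → ¬ (substr s i r).Palindrome)

/-- length of the longest proper palindromic suffix of `t`. -/
def linklen (t : List α) : ℕ :=
  sSup {l | l < t.length ∧ (t.drop (t.length - l)).Palindrome}

/-- the longest proper palindromic suffix of `t` (possibly `[]`). -/
def link (t : List α) : List α := t.drop (t.length - linklen t)

/-- `overline-occ`: shifted occurrences `{i + |t| - |link t| : i ∈ occ s t}`. -/
def obar (s t : List α) : Set ℕ := (fun i => i + t.length - (link t).length) '' occ s t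

/-- Eq.(★): the family `S` of reduced occurrence sets represents `occ` for `s`. -/
def SatStar (s : List α) (S : List α → Set ℕ) : Prop :=
  ∀ v, IsPalSub s v →
    occ s v = S v ∪ ⋃ u ∈ {u : List α | IsPalSub s u ∧ link u = v}, (occ s u ∪ obar s u)

/-- number of non-empty palindromic substrings of `s` linking to `v`. -/
def linkcnt (s v : List α) : ℕ := {u | IsPalSub s u ∧ link u = v}.ncard

def precnt (s v : List α) : ℕ := {i | 1 ≤ i ∧ i ≤ s.length ∧ prepal s i = v}.ncard

def sufcnt (s v : List α) : ℕ := {i | 1 ≤ i ∧ i ≤ s.length ∧ sufpal s i = v}.ncard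

def cnt (s v : List α) : ℕ := sufcnt s v

/-- surfaced occurrences of `v` in `s`. -/
def surf (s v : List α) : Set ℕ := {i ∈ occ s v | Surface s i (i + v.length - 1)}

def presurf (s : List α) (i : ℕ) : List α :=
  if Surface s i (i + prelen s i - 1) then prepal s i else []

def sufsurf (s : List α) (i : ℕ) : List α :=
  if Surface s (i + 1 - suflen s i) i then sufpal s i else []

end DEE

namespace DEE

variable {α : Type*}

lemma mem_occ_iff {s t : List α} {i : ℕ} :
    i ∈ occ s t ↔ ∃ a b, s = a ++ t ++ b ∧ i = a.length + 1 := by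
  constructor
  · rintro ⟨hi, hle, ht⟩
    refine ⟨s.take (i - 1), (s.drop (i - 1)).drop t.length, ?_, ?_⟩
    · nth_rewrite 1 [← ht]
      rw [List.append_assoc, List.take_append_drop, List.take_append_drop]
    · rw [List.length_take]
      omega
  · rintro ⟨a, b, rfl, rfl⟩
    refine ⟨by omega, ?_, ?_⟩
    · simp only [List.length_append]
      omega
    · simp

lemma occ_subset_append (s r t : List α) : occ s t ⊆ occ (s ++ r) t := by
  intro i hi
  obtain ⟨a, b, rfl, rfl⟩ := mem_occ_iff.1 hi
  exact mem_occ_iff.2 ⟨a, b ++ r, by simp, rfl⟩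

lemma IsPalSub.append {s v : List α} (h : IsPalSub s v) (r : List α) : IsPalSub (s ++ r) v :=
  ⟨h.1, h.2.1, h.2.2.trans (List.prefix_append s r).isInfix⟩

lemma isInfix_of_mem_occ {s t : List α} {i : ℕ} (h : i ∈ occ s t) : t <:+: s := by
  obtain ⟨a, b, rfl, -⟩ := mem_occ_iff.1 h
  exact ⟨a, b, rfl⟩

lemma mem_occ_concat {s t : List α} {c : α} {i : ℕ} (h : i ∈ occ (s ++ [c]) t) :
    i ∈ occ s t ∨ (t <:+ s ++ [c] ∧ i + t.length = (s ++ [c]).length + 1) := by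
  obtain ⟨a, b, hab, rfl⟩ := mem_occ_iff.1 h
  rcases List.eq_nil_or_concat b with rfl | ⟨b, d, rfl⟩
  · rw [List.append_nil] at hab
    refine Or.inr ⟨⟨a, hab.symm⟩, ?_⟩
    rw [hab, List.length_append]
    omega
  · rw [List.concat_eq_append, ← List.append_assoc] at hab
    exact Or.inl (mem_occ_iff.2 ⟨a, b, (List.append_inj' hab rfl).1, rfl⟩)

lemma mem_occ_of_isSuffix {s t : List α} (h : t <:+ s) : s.length - t.length + 1 ∈ occ s t := by
  obtain ⟨a, rfl⟩ := h
  exact mem_occ_iff.2 ⟨a, [], by simp, by simp⟩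

lemma linklen_mem {t : List α} (ht : t ≠ []) :
    linklen t ∈ {l | l < t.length ∧ (t.drop (t.length - l)).Palindrome} := by
  refine Nat.sSup_mem ⟨0, List.length_pos_iff.2 ht, ?_⟩ ⟨t.length, fun l hl => hl.1.le⟩
  simpa using List.Palindrome.nil

lemma link_isSuffix (t : List α) : link t <:+ t := List.drop_suffix _ _

lemma link_palindrome {t : List α} (ht : t ≠ []) : (link t).Palindrome := (linklen_mem ht).2

lemma length_link {t : List α} (ht : t ≠ []) : (link t).length = linklen t := by
  have := (linklen_mem ht).1
  rw [link, List.length_drop]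
  omega

lemma length_link_lt {t : List α} (ht : t ≠ []) : (link t).length < t.length :=
  (length_link ht).trans_lt (linklen_mem ht).1

lemma length_le_length_link {t w : List α} (hw : w.Palindrome) (hs : w <:+ t)
    (hlt : w.length < t.length) : w.length ≤ (link t).length := by
  rw [length_link (by rintro rfl; simp at hlt)]
  refine le_csSup ⟨t.length, fun l hl => hl.1.le⟩ ⟨hlt, ?_⟩
  rwa [← List.suffix_iff_eq_drop.1 hs]

lemma link_isPrefix {t : List α} (ht : t ≠ []) (hp : t.Palindrome) : link t <+: t := by
  have h := List.reverse_prefix.2 (link_isSuffix t)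
  rwa [(link_palindrome ht).reverse_eq, hp.reverse_eq] at h

lemma eq_of_isSuffix_of_length_eq {s v w : List α} (hv : v <:+ s) (hw : w <:+ s)
    (h : v.length = w.length) : v = w :=
  (List.suffix_of_suffix_length_le hv hw h.le).eq_of_length h

lemma occ_subset_occ_link {s t : List α} (ht : t ≠ []) (hp : t.Palindrome) :
    occ s t ⊆ occ s (link t) := by
  intro i hi
  obtain ⟨a, b, rfl, rfl⟩ := mem_occ_iff.1 hi
  obtain ⟨r, hr⟩ := link_isPrefix ht hp
  refine mem_occ_iff.2 ⟨a, r ++ b, ?_, rfl⟩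
  nth_rewrite 1 [← hr]
  simp

lemma obar_subset_occ_link (s t : List α) : obar s t ⊆ occ s (link t) := by
  rintro _ ⟨i, hi, rfl⟩
  obtain ⟨a, b, rfl, rfl⟩ := mem_occ_iff.1 hi
  obtain ⟨r, hr⟩ := link_isSuffix t
  refine mem_occ_iff.2 ⟨a ++ r, b, ?_, ?_⟩
  · nth_rewrite 1 [← hr]
    simp
  · have := congrArg List.length hr
    simp only [List.length_append] at this ⊢
    omega

/-- `sufpal s |s|` is the longest palindromic suffix of a non-empty string `s`. -/
lemma sufpal_length_spec {s : List α} (hs : s ≠ []) :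
    sufpal s s.length <:+ s ∧ (sufpal s s.length).Palindrome ∧
      ∀ w, w ≠ [] → w.Palindrome → w <:+ s → w.length ≤ (sufpal s s.length).length := by
  have hsub : ∀ l, l ≤ s.length →
      substr s (s.length + 1 - l) s.length = s.drop (s.length - l) := by
    intro l hl
    rw [substr, show s.length + 1 - l - 1 = s.length - l by omega, List.take_of_length_le]
    rw [List.length_drop]
    omega
  have hbdd : BddAbove {l | 1 ≤ l ∧ l ≤ s.length ∧
      (substr s (s.length + 1 - l) s.length).Palindrome} := ⟨s.length, fun l hl => hl.2.1⟩
  have hmem : ∀ w, w ≠ [] → w.Palindrome → w <:+ s → w.length ∈ {l | 1 ≤ l ∧ l ≤ s.length ∧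
      (substr s (s.length + 1 - l) s.length).Palindrome} := by
    intro w hw hp hws
    refine ⟨List.length_pos_iff.2 hw, hws.length_le, ?_⟩
    rwa [hsub _ hws.length_le, ← List.suffix_iff_eq_drop.1 hws]
  have hne := hmem [s.getLast hs] (by simp) (List.Palindrome.singleton _)
    ⟨s.dropLast, List.dropLast_append_getLast hs⟩
  obtain ⟨-, hle, hpal⟩ := Nat.sSup_mem ⟨_, hne⟩ hbdd
  have heq : sufpal s s.length = s.drop (s.length - suflen s s.length) := hsub _ hle
  have hlen : (sufpal s s.length).length = suflen s s.length := by
    have : suflen s s.length ≤ s.length := hle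
    rw [heq, List.length_drop]
    omega
  refine ⟨heq ▸ List.drop_suffix _ _, hpal, fun w hw hp hws => ?_⟩
  rw [hlen]
  exact le_csSup hbdd (hmem w hw hp hws)

/-- Every palindromic suffix shorter than another one is the link of a palindromic suffix. -/
lemma exists_link_eq {s v w : List α} (hv : v.Palindrome) (hvs : v <:+ s) (hw : w.Palindrome)
    (hws : w <:+ s) (hlt : v.length < w.length) :
    ∃ u, u ≠ [] ∧ u.Palindrome ∧ u <:+ s ∧ link u = v := by
  classical
  have hex : ∃ l, ∃ u : List α, u.Palindrome ∧ u <:+ s ∧ v.length < u.length ∧ u.length = l :=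
    ⟨_, w, hw, hws, hlt, rfl⟩
  obtain ⟨u, hu, hus, hvu, hul⟩ := Nat.find_spec hex
  have hne : u ≠ [] := by
    rintro rfl
    simp at hvu
  have hlu := (link_isSuffix u).trans hus
  refine ⟨u, hne, hu, hus, eq_of_isSuffix_of_length_eq hlu hvs (le_antisymm ?_ ?_)⟩
  · by_contra! h
    have := Nat.find_min' hex ⟨link u, link_palindrome hne, hlu, h, rfl⟩
    have := length_link_lt hne
    omega
  · exact length_le_length_link hv (List.suffix_of_suffix_length_le hvs hus hvu.le) hvu

end DEE

/-- (`push_back` correctness.) If `S` satisfies Eq.(★) for `s` (and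
`S(v) = ∅` for `v` not a palindromic substring of `s`), then the family obtained by adding
the position `|sc| - |v'| + 1` to `S(v')`, where `v'` is the longest palindromic suffix of
`sc`, satisfies Eq.(★) for `sc`. -/
theorem push_back_occurrence_recording {α : Type*} (s : List α) (c : α)
    (S : List α → Set ℕ) (hS : DEE.SatStar s S)
    (hS0 : ∀ v, ¬ DEE.IsPalSub s v → S v = ∅) :
    DEE.SatStar (s ++ [c])
      (fun v =>
        if v = DEE.sufpal (s ++ [c]) (s ++ [c]).length then
          S v ∪ {(s ++ [c]).length - (DEE.sufpal (s ++ [c]) (s ++ [c]).length).length + 1}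
        else S v) := by
  open DEE in
  obtain ⟨hsuf, hpal, hmax⟩ := sufpal_length_spec (s := s ++ [c]) (by simp)
  generalize sufpal (s ++ [c]) (s ++ [c]).length = v' at hsuf hpal hmax ⊢
  intro v hv
  have hSv : ∀ T, S v ⊆ if v = v' then S v ∪ T else S v := by
    intro T
    split_ifs
    exacts [Set.subset_union_left, subset_rfl]
  refine Set.Subset.antisymm (fun i hi => ?_) (Set.union_subset ?_ ?_)
  · rcases mem_occ_concat hi with hi | ⟨hvs, hlen⟩
    · rw [hS v ⟨hv.1, hv.2.1, isInfix_of_mem_occ hi⟩] at hi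
      refine hi.imp (fun h => hSv _ h) (fun h => ?_)
      obtain ⟨u, ⟨hu, hl⟩, h⟩ := Set.mem_iUnion₂.1 h
      exact Set.mem_iUnion₂.2 ⟨u, ⟨hu.append [c], hl⟩,
        Set.union_subset_union (occ_subset_append s [c] u)
          (Set.image_mono (occ_subset_append s [c] u)) h⟩
    · by_cases hvv : v = v'
      · left
        dsimp only
        rw [if_pos hvv, ← hvv]
        right
        have := hvs.length_le
        rw [Set.mem_singleton_iff]
        omega
      · have hlt : v.length < v'.length := (hmax v hv.1 hv.2.1 hvs).lt_of_ne
          fun h => hvv (eq_of_isSuffix_of_length_eq hvs hsuf h)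
        obtain ⟨u, hne, hu, hus, hl⟩ := exists_link_eq hv.2.1 hvs hpal hsuf hlt
        refine Or.inr (Set.mem_iUnion₂.2 ⟨u, ⟨⟨hne, hu, hus.isInfix⟩, hl⟩, Or.inr
          ⟨_, mem_occ_of_isSuffix hus, ?_⟩⟩)
        have := hus.length_le
        dsimp only
        rw [hl]
        omega
  · have hsub : S v ⊆ occ (s ++ [c]) v := by
      by_cases h : IsPalSub s v
      · refine Set.Subset.trans ?_ (occ_subset_append s [c] v)
        rw [hS v h]
        exact Set.subset_union_left
      · rw [hS0 v h]
        exact Set.empty_subset _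
    dsimp only
    split_ifs with hvv
    · refine Set.union_subset hsub (Set.singleton_subset_iff.2 ?_)
      rw [hvv]
      exact mem_occ_of_isSuffix hsuf
    · exact hsub
  · refine Set.iUnion₂_subset fun u hu => ?_
    obtain ⟨hu, rfl⟩ := hu
    exact Set.union_subset (occ_subset_occ_link hu.1 hu.2.1) (obar_subset_occ_link _ u)
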